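/- Every matroid M admits a linked tree-decomposition of width at most tw(M). -/

import Mathlib

open scoped Classical

noncomputable section

/-- An oriented separation of `V`: an ordered pair of subsets. -/
abbrev OSep (V : Type*) := Set V × Set V

namespace OSep

/-- The involution `(A,B)* = (B,A)`. -/
def flip {V : Type*} (s : OSep V) : OSep V := (s.2, s.1)

/-- The partial order `(A,B) ≤ (C,D) iff A ⊆ C and D ⊆ B`. -/
def le {V : Type*} (s t : OSep V) : Prop := s.1 ⊆ t.1 ∧ t.2 ⊆ s.2

/-- The infimum `(A,B) ∧ (C,D) = (A ∩ C, B ∪ D)`. -/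
def inter {V : Type*} (s t : OSep V) : OSep V := (s.1 ∩ t.1, s.2 ∪ t.2)

/-- The supremum `(A,B) ∨ (C,D) = (A ∪ C, B ∩ D)`. -/
def union {V : Type*} (s t : OSep V) : OSep V := (s.1 ∪ t.1, s.2 ∩ t.2)

end OSep

/-- A universe of set separations: a set of oriented separations (pairs covering `V`)
closed under the involution and under ∧ and ∨. -/
structure IsUniverse {V : Type*} (S : Set (OSep V)) : Prop where
  covers : ∀ s ∈ S, s.1 ∪ s.2 = Set.univ
  flip_mem : ∀ s ∈ S, s.flip ∈ S
  inter_mem : ∀ s ∈ S, ∀ t ∈ S, s.inter t ∈ S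
  union_mem : ∀ s ∈ S, ∀ t ∈ S, s.union t ∈ S

/-- An order function on a universe `S`: symmetric and submodular (non-negativity is
automatic for `ℕ`-valued functions). -/
structure IsOrderFun {V : Type*} (S : Set (OSep V)) (ord : OSep V → ℕ) : Prop where
  symm : ∀ s ∈ S, ord s.flip = ord s
  submod : ∀ s ∈ S, ∀ t ∈ S, ord (s.inter t) + ord (s.union t) ≤ ord s + ord t

/-- A universe with an order function is grounded if `|A ∪ C, B ∩ D| ≤ |C,D|`
whenever `(B,A) ≤ (C,D)`. -/
def Grounded {V : Type*} (S : Set (OSep V)) (ord : OSep V → ℕ) : Prop :=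
  ∀ s ∈ S, ∀ t ∈ S, OSep.le s.flip t → ord (s.union t) ≤ ord t

/-- A submodular function on subsets of `V`. -/
def Submodular {V : Type*} (r : Set V → ℕ) : Prop :=
  ∀ X Y : Set V, r (X ∩ Y) + r (X ∪ Y) ≤ r X + r Y

/-- The order function `|X,Y|_r = r(X) + r(Y) - r(V)` induced by `r`. -/
def ordOf {V : Type*} (r : Set V → ℕ) (s : OSep V) : ℕ := r s.1 + r s.2 - r Set.univ

/-- A multiset of oriented separations is a star if `(A,B) ≤ (D,C)` for every two of its
members occupying distinct positions. -/
def IsStar {V : Type*} (σ : Multiset (OSep V)) : Prop :=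
  ∀ a b : OSep V, (a ::ₘ {b}) ≤ σ → OSep.le a b.flip

/-- The size `⟨σ⟩_r = Σᵢ r(Bᵢ) − n · r(V)` of a star `σ = {(A₀,B₀),…,(Aₙ,Bₙ)}`. -/
def starSize {V : Type*} (r : Set V → ℕ) (σ : Multiset (OSep V)) : ℕ :=
  (σ.map fun s => r s.2).sum - (Multiset.card σ - 1) * r Set.univ

/-- `λ((A,B),(C,D)) = min { |X,Y| : (X,Y) ∈ S, (A,B) ≤ (X,Y) ≤ (C,D) }`. -/
def lam {V : Type*} (S : Set (OSep V)) (ord : OSep V → ℕ) (a c : OSep V) : ℕ :=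
  sInf (ord '' {s | s ∈ S ∧ OSep.le a s ∧ OSep.le s c})

/-- `(X,Y)` is linked to `(A,B)` if `(A,B) ≤ (X,Y)` and `|X,Y| = λ((A,B),(X,Y))`. -/
def IsLinkedSep {V : Type*} (S : Set (OSep V)) (ord : OSep V → ℕ) (a x : OSep V) : Prop :=
  x ∈ S ∧ OSep.le a x ∧ ord x = lam S ord a x

/-- `σ_t`: the multiset of labels of the oriented edges (darts) pointing towards `t`. -/
def starAt {W : Type*} [Fintype W] {V : Type*} (T : SimpleGraph W) (α : T.Dart → OSep V)
    (t : W) : Multiset (OSep V) :=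
  ((Finset.univ : Finset T.Dart).filter fun d => d.toProd.2 = t).val.map α

/-- The natural ordering on the oriented edges (darts) of a tree: `d ≤ d'` iff both lie
(in that direction) on the path from the tail of `d` to the head of `d'`. -/
def dartLE {W : Type*} (T : SimpleGraph W) (d d' : T.Dart) : Prop :=
  ∀ p : T.Walk d.toProd.1 d'.toProd.2, p.IsPath → d ∈ p.darts ∧ d' ∈ p.darts

/-- The vertex set of the subtree `T(e⃗)`: the component of `T - x` containing `y` together
with `x` itself, for `e⃗ = (x,y)`. -/
def shiftSet {W : Type*} (T : SimpleGraph W) (e : T.Dart) : Set W :=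
  {v | v = e.toProd.1 ∨ ∀ p : T.Walk e.toProd.1 v, p.IsPath → e ∈ p.darts}

/-- A dart of an induced subgraph, as a dart of the ambient graph. -/
def liftDart {W : Type*} {T : SimpleGraph W} {U : Set W} (d : (T.induce U).Dart) : T.Dart :=
  ⟨(d.toProd.1.val, d.toProd.2.val), d.adj⟩

/-- The labelling `α'` of the shift of `(T,α)` onto `(X,Y)` with respect to `e⃗`:
a dart `f` of `T(e⃗)` with `e⃗ ≤ f⃗` gets `α(f⃗) ∨ (X,Y)`, and the reverse darts get the
flipped labels. -/
def shiftAlpha {W : Type*} {V : Type*} (T : SimpleGraph W) (α : T.Dart → OSep V)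
    (e : T.Dart) (X : OSep V) : (T.induce (shiftSet T e)).Dart → OSep V :=
  fun d =>
    if dartLE T e (liftDart d) then (α (liftDart d)).union X
    else ((α (liftDart d).symm).union X).flip

/-- A family `F` of stars is fixed under shifting if for every tame `S`-tree `(T,α)`,
every oriented edge `e⃗ = (t,t')` of `T`, every vertex `s ≠ t` of `T(e⃗)` with
`α(F⃗_s) ∈ F`, and every `(X,Y)` linked to `α(e⃗)`, in the shift of `(T,α)` onto `(X,Y)`
with respect to `e⃗` one has `α'(F⃗_s) ∈ F`. -/
def FixedUnderShifting {V : Type*} (S : Set (OSep V)) (ord : OSep V → ℕ)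
    (F : Set (Multiset (OSep V))) : Prop :=
  ∀ (n : ℕ) (T : SimpleGraph (Fin n)) (α : T.Dart → OSep V) (e : T.Dart) (X : OSep V)
    (s : ↥(shiftSet T e)),
    T.IsTree → (∀ d, α d.symm = (α d).flip) → (∀ d, α d ∈ S) →
    (∀ t, IsStar (starAt T α t)) →
    (s : Fin n) ≠ e.toProd.1 → starAt T α (s : Fin n) ∈ F →
    IsLinkedSep S ord (α e) X →
    starAt (T.induce (shiftSet T e)) (shiftAlpha T α e X) s ∈ F

/-- A linked `S_k`-tree: for every two darts `e⃗ ≤ f⃗`, the minimum order of a label on the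
path from `e` to `f` equals `λ(α(e⃗), α(f⃗))`. -/
def IsLinkedTree {W : Type*} {V : Type*} (S : Set (OSep V)) (ord : OSep V → ℕ)
    (T : SimpleGraph W) (α : T.Dart → OSep V) : Prop :=
  ∀ e f : T.Dart, dartLE T e f →
    sInf ((fun g => ord (α g)) '' {g | dartLE T e g ∧ dartLE T g f}) =
      lam S ord (α e) (α f)

/-- An `F`-lean `S_k`-tree with respect to the ground function `r`. -/
def IsLeanTree {W : Type*} [Fintype W] {V : Type*} (S : Set (OSep V)) (ord : OSep V → ℕ)
    (r : Set V → ℕ) (T : SimpleGraph W) (α : T.Dart → OSep V)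
    (F : Set (Multiset (OSep V))) : Prop :=
  ∀ (t t' : W) (a b : OSep V), OSep.le a b.flip →
    (a ::ₘ starAt T α t) ∈ F → (b ::ₘ starAt T α t') ∈ F →
    (min (r a.1) (r b.1) ≤ lam S ord a b.flip ∨
      ∀ p : T.Walk t t', p.IsPath →
        sInf ((fun d => ord (α d)) '' {d | d ∈ p.darts}) = lam S ord a b.flip)

/-- `int(σ) = ⋂ᵢ Bᵢ` for `σ = {(A₀,B₀),…,(Aₙ,Bₙ)}`. -/
def intStar {V : Type*} (σ : Multiset (OSep V)) : Set V := {v | ∀ s ∈ σ, v ∈ s.2}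

/-- The universe of oriented separations of a graph `G`: pairs `(A,B)` of vertex sets with
`A ∪ B = V(G)` and no edge between `A ∖ B` and `B ∖ A`. -/
def graphSeps {V : Type*} (G : SimpleGraph V) : Set (OSep V) :=
  {s | s.1 ∪ s.2 = Set.univ ∧ ∀ a ∈ s.1 \ s.2, ∀ b ∈ s.2 \ s.1, ¬ G.Adj a b}

/-- `G` contains `k` vertex-disjoint `Z₁`–`Z₂` paths. -/
def HasDisjointPaths {V : Type*} (G : SimpleGraph V) (Z₁ Z₂ : Set V) (k : ℕ) : Prop :=
  ∃ (u v : Fin k → V) (p : ∀ i, G.Walk (u i) (v i)),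
    (∀ i, (p i).IsPath) ∧ (∀ i, u i ∈ Z₁) ∧ (∀ i, v i ∈ Z₂) ∧
    ∀ i j, i ≠ j → ∀ x, x ∈ (p i).support → x ∉ (p j).support

/-- `(T, B)` is a tree-decomposition of the graph `G`. -/
def IsTreeDecomp {V : Type*} {n : ℕ} (G : SimpleGraph V) (T : SimpleGraph (Fin n))
    (B : Fin n → Set V) : Prop :=
  T.IsTree ∧ (∀ v, ∃ t, v ∈ B t) ∧ (∀ u w, G.Adj u w → ∃ t, u ∈ B t ∧ w ∈ B t) ∧
  (∀ t₁ t₂ t₃ : Fin n, ∀ p : T.Walk t₁ t₃, p.IsPath → t₂ ∈ p.support → B t₁ ∩ B t₃ ⊆ B t₂)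

/-- The width of a tree-decomposition: `max |V_t| − 1`. -/
def tdWidth {V : Type*} {n : ℕ} (B : Fin n → Set V) : ℕ :=
  (Finset.univ.sup fun t => (B t).ncard) - 1

/-- The tree-width of a graph. -/
def treeWidth {V : Type*} (G : SimpleGraph V) : ℕ :=
  sInf {w | ∃ (n : ℕ) (T : SimpleGraph (Fin n)) (B : Fin n → Set V),
    IsTreeDecomp G T B ∧ tdWidth B = w}

/-- The path-width of a graph: minimum width of a tree-decomposition whose tree is a path. -/
def pathWidth {V : Type*} (G : SimpleGraph V) : ℕ :=
  sInf {w | ∃ (n : ℕ) (B : Fin n → Set V),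
    IsTreeDecomp G (SimpleGraph.pathGraph n) B ∧ tdWidth B = w}

/-- A linked tree-decomposition of a graph. -/
def IsLinkedDecomp {V : Type*} {n : ℕ} (G : SimpleGraph V) (T : SimpleGraph (Fin n))
    (B : Fin n → Set V) : Prop :=
  ∀ (k : ℕ) (t t' : Fin n),
    HasDisjointPaths G (B t) (B t') k ∨
    ∀ p : T.Walk t t', p.IsPath →
      ∃ d ∈ p.darts, (B d.toProd.1 ∩ B d.toProd.2).ncard < k

/-- A lean tree-decomposition of a graph. -/
def IsLeanDecomp {V : Type*} {n : ℕ} (G : SimpleGraph V) (T : SimpleGraph (Fin n))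
    (B : Fin n → Set V) : Prop :=
  ∀ (k : ℕ) (t t' : Fin n) (Z₁ Z₂ : Set V), Z₁ ⊆ B t → Z₂ ⊆ B t' →
    Z₁.ncard = k → Z₂.ncard = k →
    HasDisjointPaths G Z₁ Z₂ k ∨
    ∀ p : T.Walk t t', p.IsPath →
      ∃ d ∈ p.darts, (B d.toProd.1 ∩ B d.toProd.2).ncard < k
/-- The rank function of a matroid: `r(X)` is the maximum size of an independent subset
of `X`. -/
def mRank {α : Type*} (M : Matroid α) (X : Set α) : ℕ :=
  sSup {k | ∃ I, I ⊆ X ∧ M.Indep I ∧ I.ncard = k}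

/-- The connectivity `λ(X) = r(X) + r(E ∖ X) − r(E)` of `X ⊆ E`. -/
def mConn {α : Type*} (M : Matroid α) (X : Set α) : ℕ :=
  mRank M X + mRank M Xᶜ - mRank M Set.univ

/-- For a dart `d = (s,s')` of a tree `T`, the component of `T − s'` containing `s`. -/
def branch {W : Type*} (T : SimpleGraph W) (d : T.Dart) : Set W :=
  {w | ∀ p : T.Walk d.toProd.2 w, p.IsPath → d.toProd.1 ∈ p.support}

/-- The darts of `T` pointing towards `t`. -/
def dartsTo {W : Type*} [Fintype W] (T : SimpleGraph W) (t : W) : Finset T.Dart :=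
  Finset.univ.filter fun d => d.toProd.2 = t

/-- The width `Σᵢ r(E ∖ τ⁻¹(Tᵢ)) − (d−1)·r(E)` of the bag of a matroid tree-decomposition
at `v`, where the `Tᵢ` are the components of `T − v`. -/
def mBagWidth {α : Type*} {n : ℕ} (M : Matroid α) (T : SimpleGraph (Fin n))
    (τ : α → Fin n) (v : Fin n) : ℕ :=
  ((∑ d ∈ dartsTo T v, mRank M ((τ ⁻¹' branch T d)ᶜ)) + mRank M Set.univ)
    - (dartsTo T v).card * mRank M Set.univ

/-- The width of a matroid tree-decomposition: the maximum width of a bag. -/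
def mWidth {α : Type*} {n : ℕ} (M : Matroid α) (T : SimpleGraph (Fin n))
    (τ : α → Fin n) : ℕ :=
  Finset.univ.sup (mBagWidth M T τ)

/-- The tree-width of a matroid. -/
def matroidTreeWidth {α : Type*} (M : Matroid α) : ℕ :=
  sInf {w | ∃ (n : ℕ) (T : SimpleGraph (Fin n)) (_ : T.IsTree) (τ : α → Fin n),
    mWidth M T τ = w}

/-- `λ(Z₁,Z₂) = min {λ(X) : Z₁ ⊆ X ⊆ E ∖ Z₂}` for disjoint `Z₁, Z₂ ⊆ E`. -/
def mLam {α : Type*} (M : Matroid α) (Z₁ Z₂ : Set α) : ℕ :=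
  sInf (mConn M '' {X | Z₁ ⊆ X ∧ X ⊆ Z₂ᶜ})

/-- A lean matroid tree-decomposition. -/
def IsLeanMDecomp {α : Type*} {n : ℕ} (M : Matroid α) (T : SimpleGraph (Fin n))
    (τ : α → Fin n) : Prop :=
  ∀ (k : ℕ) (t t' : Fin n) (Z₁ Z₂ : Set α), Z₁ ⊆ τ ⁻¹' {t} → Z₂ ⊆ τ ⁻¹' {t'} →
    Disjoint Z₁ Z₂ → mRank M Z₁ = k → mRank M Z₂ = k →
    k ≤ mLam M Z₁ Z₂ ∨
    ∀ p : T.Walk t t', p.IsPath → ∃ d ∈ p.darts, mConn M (τ ⁻¹' branch T d) < k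

/-- A linked matroid tree-decomposition. -/
def IsLinkedMDecomp {α : Type*} {n : ℕ} (M : Matroid α) (T : SimpleGraph (Fin n))
    (τ : α → Fin n) : Prop :=
  ∀ e f : T.Dart, dartLE T e f →
    sInf ((fun g => mConn M (τ ⁻¹' branch T g)) '' {g | dartLE T e g ∧ dartLE T g f}) =
      sInf (mConn M '' {X | τ ⁻¹' branch T e ⊆ X ∧ X ⊆ τ ⁻¹' branch T f})
/-- Two oriented separations are nested if they have `≤`-comparable orientations. -/
def Nested {V : Type*} (s t : OSep V) : Prop :=
  OSep.le s t ∨ OSep.le s t.flip ∨ OSep.le s.flip t ∨ OSep.le s.flip t.flip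

section Cuts

variable {W : Type*} {T : SimpleGraph W}

/-- The vertices `w` all of whose paths from `v` pass through `u`. -/
def side (T : SimpleGraph W) (u v : W) : Set W :=
  {w | ∀ p : T.Walk v w, p.IsPath → u ∈ p.support}

/-- `B` contains `u` but not `v`, and `uv` is the only edge leaving `B`. -/
structure IsCut (T : SimpleGraph W) (u v : W) (B : Set W) : Prop where
  left_mem : u ∈ B
  right_notMem : v ∉ B
  eq_of_adj : ∀ a b, T.Adj a b → a ∈ B → b ∉ B → a = u ∧ b = v

lemma IsCut.compl {u v : W} {B : Set W} (h : IsCut T u v B) : IsCut T v u Bᶜ where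
  left_mem := h.right_notMem
  right_notMem := by simpa using h.left_mem
  eq_of_adj a b hab ha hb := (h.eq_of_adj b a hab.symm (by simpa using hb) ha).symm

lemma IsCut.eq_side (hT : T.Connected) {u v : W} {B : Set W} (h : IsCut T u v B) :
    B = side T u v := by
  ext w
  constructor
  · intro hw p _
    obtain ⟨d, hd, h1, h2⟩ := p.exists_boundary_dart Bᶜ h.right_notMem (by simpa using hw)
    have := h.eq_of_adj _ _ d.adj.symm (by simpa using h2) h1
    rw [← this.1]
    exact p.dart_snd_mem_support_of_mem_darts hd
  · intro hw
    by_contra hwB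
    obtain ⟨p, hp⟩ := hT.exists_isPath v w
    have hu := hw p hp
    cases p with
    | nil =>
      simp only [SimpleGraph.Walk.support_nil, List.mem_singleton] at hu
      exact h.right_notMem (hu ▸ h.left_mem)
    | cons hadj q =>
      rw [SimpleGraph.Walk.cons_isPath_iff] at hp
      rw [SimpleGraph.Walk.support_cons, List.mem_cons] at hu
      rcases hu with hu | hu
      · exact h.right_notMem (hu ▸ h.left_mem)
      · obtain ⟨d, hd, h1, h2⟩ := (q.dropUntil u hu).exists_boundary_dart B h.left_mem hwB
        have := h.eq_of_adj _ _ d.adj h1 h2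
        apply hp.2
        rw [← this.2]
        exact q.support_dropUntil_subset_support hu
          (SimpleGraph.Walk.dart_snd_mem_support_of_mem_darts _ hd)

lemma isCut_side (hT : T.IsTree) {u v : W} (huv : T.Adj u v) : IsCut T u v (side T u v) := by
  have hb := SimpleGraph.isAcyclic_iff_forall_adj_isBridge.1 hT.isAcyclic huv
  have hcut : IsCut T u v {w | (T.deleteEdges {s(u, v)}).Reachable u w} := by
    refine ⟨SimpleGraph.Reachable.refl _, fun h => (SimpleGraph.isBridge_iff.1 hb) h, ?_⟩
    intro a b hab ha hb'
    by_contra hne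
    have hba : s(a, b) = s(u, v) := by
      by_contra hne'
      exact hb' (SimpleGraph.Reachable.trans ha
        (SimpleGraph.Adj.reachable (by simp [SimpleGraph.deleteEdges_adj, hab, hne'])))
    rcases Sym2.eq_iff.1 hba with h | h
    · exact hne h
    · obtain ⟨rfl, rfl⟩ := h
      exact hb' (SimpleGraph.Reachable.refl _)
  rwa [hcut.eq_side hT.connected] at hcut

lemma side_compl (hT : T.IsTree) {u v : W} (huv : T.Adj u v) : (side T u v)ᶜ = side T v u :=
  (isCut_side hT huv).compl.eq_side hT.connected

/-- A connected graph each of whose edges admits a cut is a tree. -/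
lemma isTree_of_isCut (hT : T.Connected) (h : ∀ u v, T.Adj u v → ∃ B, IsCut T u v B) :
    T.IsTree := by
  refine ⟨hT, SimpleGraph.isAcyclic_iff_forall_adj_isBridge.2 fun u v huv => ?_⟩
  obtain ⟨B, hB⟩ := h u v huv
  rw [SimpleGraph.isBridge_iff]
  rintro ⟨p⟩
  obtain ⟨d, -, h1, h2⟩ := p.exists_boundary_dart B hB.left_mem hB.right_notMem
  have hd := d.adj
  rw [SimpleGraph.deleteEdges_adj] at hd
  obtain ⟨h3, h4⟩ := hB.eq_of_adj _ _ hd.1 h1 h2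
  exact hd.2 (by rw [h3, h4]; rfl)

lemma eq_empty_of_adj_closed (hT : T.Connected) {B : Set W}
    (hB : ∀ a b, T.Adj a b → a ∈ B → b ∈ B) {x : W} (hx : x ∉ B) : B = ∅ := by
  by_contra hne
  obtain ⟨y, hy⟩ := Set.nonempty_iff_ne_empty.2 hne
  obtain ⟨p⟩ := hT.preconnected y x
  obtain ⟨d, -, h1, h2⟩ := p.exists_boundary_dart B hy hx
  exact h2 (hB _ _ d.adj h1)

lemma IsCut.inter_eq_empty (hT : T.Connected) {a b c d : W} {B C : Set W}
    (hB : IsCut T a b B) (hC : IsCut T c d C) (ha : a ∉ C) (hc : c ∉ B) : B ∩ C = ∅ := by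
  refine eq_empty_of_adj_closed hT (fun x y hxy hx => ?_) (x := b) fun h => hB.right_notMem h.1
  have h1 := hB.eq_of_adj x y hxy hx.1
  have h2 := hC.eq_of_adj x y hxy hx.2
  have := hx.1
  have := hx.2
  refine ⟨?_, ?_⟩ <;> by_contra <;> grind

/-- Two cuts of a connected graph are nested. -/
lemma IsCut.nested (hT : T.Connected) {a b c d : W} (hcd : T.Adj c d) (hab : T.Adj a b)
    {B C : Set W} (hB : IsCut T a b B) (hC : IsCut T c d C) :
    B ∩ C = ∅ ∨ B ⊆ C ∨ C ⊆ B ∨ B ∪ C = Set.univ := by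
  have key : ∀ {c d : W} {C : Set W}, T.Adj c d → IsCut T c d C → a ∉ C →
      B ∩ C = ∅ ∨ C ⊆ B := by
    intro c d C hcd hC ha
    by_cases hc : c ∈ B
    · right
      have hd : d ∈ B := by
        by_contra hd
        exact ha ((hB.eq_of_adj c d hcd hc hd).1 ▸ hC.left_mem)
      have hb : b ∉ C := by
        intro hb
        have := (hC.eq_of_adj b a hab.symm hb ha).1
        exact hB.right_notMem (this ▸ hc)
      have := hB.compl.inter_eq_empty hT hC hb (by simpa using hc)
      intro x hx
      by_contra hxB
      exact (this ▸ (⟨hxB, hx⟩ : x ∈ Bᶜ ∩ C) : x ∈ (∅ : Set W))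
    · exact .inl (hB.inter_eq_empty hT hC ha hc)
  by_cases ha : a ∈ C
  · rcases key hcd.symm hC.compl (by simpa using ha) with h | h
    · refine .inr (.inl fun x hx => ?_)
      by_contra hxC
      exact (h ▸ (⟨hx, hxC⟩ : x ∈ B ∩ Cᶜ) : x ∈ (∅ : Set W))
    · refine .inr (.inr (.inr (Set.eq_univ_of_forall fun x => ?_)))
      by_cases hx : x ∈ C
      · exact .inr hx
      · exact .inl (h hx)
  · rcases key hcd hC ha with h | h
    · exact .inl h
    · exact .inr (.inr (.inl h))

lemma disjoint_side_of_ne (hT : T.IsTree) {u u' v : W} (h : T.Adj u v) (h' : T.Adj u' v)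
    (hne : u ≠ u') : Disjoint (side T u v) (side T u' v) := by
  have c := isCut_side hT h
  have c' := isCut_side hT h'
  rw [Set.disjoint_iff_inter_eq_empty]
  refine c.inter_eq_empty hT.connected c' (fun hu => ?_) fun hu => ?_
  · exact hne (c'.eq_of_adj u v h hu c'.right_notMem).1
  · exact hne (c.eq_of_adj u' v h' hu c.right_notMem).1.symm

lemma exists_adj_mem_side (hT : T.IsTree) {v x : W} (hvx : v ≠ x) :
    ∃ u, T.Adj u v ∧ x ∈ side T u v := by
  obtain ⟨p, hp⟩ := hT.connected.exists_isPath v x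
  cases p with
  | nil => exact absurd rfl hvx
  | @cons _ u _ hadj q =>
    refine ⟨u, hadj.symm, fun p' hp' => ?_⟩
    have := (hT.existsUnique_path v x).unique hp hp'
    simp [← this]

/-- A side of a tree edge that misses the head of the dart `(s, t)` is contained in
or disjoint from the side of `(s, t)`. -/
lemma side_subset_or_disjoint (hT : T.IsTree) {a b s t : W} (hab : T.Adj a b) (hst : T.Adj s t)
    (ht : t ∉ side T a b) :
    side T a b ⊆ side T s t ∨ Disjoint (side T a b) (side T s t) := by
  have c := isCut_side hT hab
  have c' := isCut_side hT hst
  rcases c.nested hT.connected hst hab c' with h | h | h | h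
  · exact .inr (Set.disjoint_iff_inter_eq_empty.2 h)
  · exact .inl h
  · left
    obtain ⟨rfl, rfl⟩ := c.eq_of_adj s t hst (h c'.left_mem) ht
    exact subset_rfl
  · exact absurd (h.symm ▸ Set.mem_univ t) (by simp [ht, c'.right_notMem])

lemma branch_eq_side (d : T.Dart) : branch T d = side T d.toProd.1 d.toProd.2 := rfl

lemma dartLE_iff (hT : T.IsTree) (e f : T.Dart) :
    dartLE T e f ↔ e.toProd.1 ∈ side T f.toProd.1 f.toProd.2 ∧
      f.toProd.2 ∉ side T e.toProd.1 e.toProd.2 := by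
  have ce := isCut_side hT e.adj
  have cf := isCut_side hT f.adj
  have mem_darts : ∀ {d : T.Dart} {x y : W} (p : T.Walk x y),
      x ∈ side T d.toProd.1 d.toProd.2 → y ∉ side T d.toProd.1 d.toProd.2 → d ∈ p.darts := by
    intro d x y p hx hy
    obtain ⟨g, hg, h1, h2⟩ := p.exists_boundary_dart _ hx hy
    have := (isCut_side hT d.adj).eq_of_adj _ _ g.adj h1 h2
    rwa [← show g = d from SimpleGraph.Dart.ext _ _ (Prod.ext this.1 this.2)]
  constructor
  · intro h
    obtain ⟨p, hp⟩ := hT.connected.exists_isPath e.toProd.1 f.toProd.2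
    constructor
    · intro q hq
      have := (h q.reverse hq.reverse).2
      simpa using q.reverse.dart_fst_mem_support_of_mem_darts this
    · intro hmem
      have hep := (h p hp).1
      have hsub : ∀ {x y : W} (p : T.Walk x y), p.IsPath → ∀ e : T.Dart, x = e.toProd.1 →
          e ∈ p.darts → y ∈ side T e.toProd.1 e.toProd.2 → False := by
        intro x y p hp e hx he hy
        cases p with
        | nil => simp at he
        | cons hadj q =>
          rw [SimpleGraph.Walk.cons_isPath_iff] at hp
          rw [SimpleGraph.Walk.darts_cons, List.mem_cons] at he
          rcases he with rfl | he
          · exact hp.2 (hy q hp.1)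
          · exact hp.2 (hx ▸ q.dart_fst_mem_support_of_mem_darts he)
      exact hsub p hp e rfl hep hmem
  · rintro ⟨h1, h2⟩ p -
    exact ⟨mem_darts p ce.left_mem h2, mem_darts p h1 cf.right_notMem⟩

lemma dartLE_refl (hT : T.IsTree) (e : T.Dart) : dartLE T e e :=
  (dartLE_iff hT e e).2 ⟨(isCut_side hT e.adj).left_mem, (isCut_side hT e.adj).right_notMem⟩

lemma side_subset_of_dartLE (hT : T.IsTree) {e f : T.Dart} (h : dartLE T e f) :
    side T e.toProd.1 e.toProd.2 ⊆ side T f.toProd.1 f.toProd.2 := by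
  obtain ⟨h1, h2⟩ := (dartLE_iff hT e f).1 h
  have := (isCut_side hT e.adj).inter_eq_empty hT.connected (isCut_side hT f.adj).compl
    (by simpa using h1) h2
  intro x hx
  by_contra hxf
  exact (this ▸ (⟨hx, hxf⟩ : x ∈ side T e.toProd.1 e.toProd.2 ∩ _) : x ∈ (∅ : Set W))

/-- Every dart of a path from the tail of `e` to the head of `f`, where `e ≤ f`, lies
between `e` and `f`. -/
lemma dartLE_of_mem_darts (hT : T.IsTree) {e f g : T.Dart} (h : dartLE T e f)
    {p : T.Walk e.toProd.1 f.toProd.2} (hp : p.IsPath) (hg : g ∈ p.darts) :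
    dartLE T e g ∧ dartLE T g f := by
  have tail_mem : ∀ {x y : W} (p : T.Walk x y), p.IsPath → ∀ g ∈ p.darts,
      x ∈ side T g.toProd.1 g.toProd.2 ∧ y ∉ side T g.toProd.1 g.toProd.2 := by
    intro x y p hp g hg
    have c := isCut_side hT g.adj
    induction p with
    | nil => simp at hg
    | cons hadj q ih =>
      rw [SimpleGraph.Walk.cons_isPath_iff] at hp
      rw [SimpleGraph.Walk.darts_cons, List.mem_cons] at hg
      rcases hg with rfl | hg
      · refine ⟨c.left_mem, fun hy => hp.2 (hy q hp.1)⟩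
      · refine ⟨?_, (ih hp.1 hg).2⟩
        by_contra hx
        have := (c.eq_of_adj _ _ hadj.symm (ih hp.1 hg).1 hx).2
        exact hp.2 (this ▸ q.dart_snd_mem_support_of_mem_darts hg)
  have head_notMem : ∀ {x y : W} (p : T.Walk x y), p.IsPath → ∀ g ∈ p.darts, ∀ e : T.Dart,
      e.toProd.1 = x → y ∉ side T e.toProd.1 e.toProd.2 →
        g.toProd.2 ∉ side T e.toProd.1 e.toProd.2 := by
    intro x y p hp g hg e hx hy hmem
    cases p with
    | nil => simp at hg
    | cons hadj q =>
      rw [SimpleGraph.Walk.cons_isPath_iff] at hp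
      have hgq : g.toProd.2 ∈ q.support := by
        rw [SimpleGraph.Walk.darts_cons, List.mem_cons] at hg
        rcases hg with rfl | hg
        · exact q.start_mem_support
        · exact q.dart_snd_mem_support_of_mem_darts hg
      obtain ⟨d, hd, h1, h2⟩ := (q.dropUntil _ hgq).exists_boundary_dart _ hmem hy
      have := ((isCut_side hT e.adj).eq_of_adj _ _ d.adj h1 h2).1
      apply hp.2
      rw [← hx, ← this]
      exact q.support_dropUntil_subset_support hgq
        (SimpleGraph.Walk.dart_fst_mem_support_of_mem_darts _ hd)
  obtain ⟨h1, h2⟩ := (dartLE_iff hT e f).1 h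
  obtain ⟨h3, h4⟩ := tail_mem p hp g hg
  refine ⟨(dartLE_iff hT _ _).2 ⟨h3, head_notMem p hp g hg e rfl h2⟩,
    (dartLE_iff hT _ _).2 ⟨?_, h4⟩⟩
  have := head_notMem p.reverse hp.reverse g.symm (by simpa using hg) f.symm rfl
  rw [SimpleGraph.Dart.symm_toProd, SimpleGraph.Dart.symm_toProd] at this
  simp only [Prod.fst_swap, Prod.snd_swap, ← side_compl hT f.adj, Set.mem_compl_iff,
    not_not] at this
  exact this h1

end Cuts

section RankFunctions

variable {α : Type*}

/-- A normalized, monotone, submodular set function. -/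
structure IsRankFun (r : Set α → ℕ) : Prop where
  empty : r ∅ = 0
  mono : ∀ X Y, X ⊆ Y → r X ≤ r Y
  submod : Submodular r

/-- The connectivity function of `r`. -/
def conn (r : Set α → ℕ) (X : Set α) : ℕ := r X + r Xᶜ - r Set.univ

variable {r : Set α → ℕ}

lemma conn_compl (X : Set α) : conn r Xᶜ = conn r X := by
  rw [conn, conn, compl_compl, add_comm]

lemma IsRankFun.conn_add (hr : IsRankFun r) (X : Set α) :
    conn r X + r Set.univ = r X + r Xᶜ := by
  have := hr.submod X Xᶜ
  rw [Set.union_compl_self] at this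
  unfold conn
  omega

lemma IsRankFun.conn_empty (hr : IsRankFun r) : conn r ∅ = 0 := by
  simp [conn, hr.empty]

lemma IsRankFun.conn_submod (hr : IsRankFun r) (X Y : Set α) :
    conn r (X ∩ Y) + conn r (X ∪ Y) ≤ conn r X + conn r Y := by
  have h1 := hr.submod X Y
  have h2 := hr.submod Xᶜ Yᶜ
  rw [← Set.compl_union, ← Set.compl_inter] at h2
  have := hr.conn_add X
  have := hr.conn_add Y
  have := hr.conn_add (X ∩ Y)
  have := hr.conn_add (X ∪ Y)
  omega

lemma IsRankFun.sum_compl_diff_le (hr : IsRankFun r) {ι : Type*} (s : Finset ι) (G : ι → Set α)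
    (X : Set α) (hG : (s : Set ι).PairwiseDisjoint G) :
    ∑ u ∈ s, ((r (G u \ X)ᶜ : ℤ) - r (G u)ᶜ) ≤ r X - r (X \ ⋃ u ∈ s, G u) := by
  induction s using Finset.induction_on with
  | empty => simp
  | insert a s ha ih =>
    rw [Finset.sum_insert ha]
    have ih := ih (hG.subset (by simp))
    have hdisj : ∀ u ∈ s, Disjoint (G a) (G u) := fun u hu =>
      hG (by simp) (by simp [hu]) (by rintro rfl; exact ha hu)
    have h := hr.submod (G a)ᶜ (X \ ⋃ u ∈ s, G u)
    have h1 : (G a)ᶜ ∪ (X \ ⋃ u ∈ s, G u) = (G a \ X)ᶜ := by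
      ext y
      have : y ∈ G a → y ∉ ⋃ u ∈ s, G u := by
        intro hy hy'
        simp only [Set.mem_iUnion] at hy'
        obtain ⟨u, hu, hyu⟩ := hy'
        exact Set.disjoint_left.1 (hdisj u hu) hy hyu
      simp only [Set.mem_union, Set.mem_compl_iff, Set.mem_sdiff]
      tauto
    have h2 : (G a)ᶜ ∩ (X \ ⋃ u ∈ s, G u) = X \ ⋃ u ∈ insert a s, G u := by
      ext y
      simp only [Finset.set_biUnion_insert, Set.mem_inter_iff, Set.mem_union, Set.mem_compl_iff,
        Set.mem_sdiff]
      tauto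
    rw [h1, h2] at h
    have h' : (r (X \ ⋃ u ∈ insert a s, G u) : ℤ) + r (G a \ X)ᶜ ≤
      r (G a)ᶜ + r (X \ ⋃ u ∈ s, G u) := by exact_mod_cast h
    linarith

/-- Shifting a star of pairwise disjoint sets onto `X` does not increase its size. -/
lemma IsRankFun.sum_shift_le (hr : IsRankFun r) {ι : Type*} (s : Finset ι) (G : ι → Set α)
    (X : Set α) (hG : (s : Set ι).PairwiseDisjoint G) {a : ι} (ha : a ∈ s)
    (hX : conn r X ≤ conn r (G a ∩ X)) :
    ∑ u ∈ s, ((r Set.univ : ℤ) - r (G u)ᶜ) ≤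
      (r Set.univ - r (G a ∪ X)ᶜ) + ∑ u ∈ s.erase a, ((r Set.univ : ℤ) - r (G u \ X)ᶜ) := by
  have h1 := hr.sum_compl_diff_le (s.erase a) G X (hG.subset (by simp))
  have h2 : r (G a ∩ X) ≤ r (X \ ⋃ u ∈ s.erase a, G u) := by
    refine hr.mono _ _ fun y hy => ⟨hy.2, ?_⟩
    simp only [Set.mem_iUnion, not_exists]
    intro u hu hyu
    rw [Finset.mem_erase] at hu
    exact Set.disjoint_left.1 (hG ha hu.2 hu.1.symm) hy.1 hyu
  have h3 := hr.submod (G a)ᶜ Xᶜ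
  rw [← Set.compl_union, ← Set.compl_inter] at h3
  have h4 := hr.conn_add X
  have h5 := hr.conn_add (G a ∩ X)
  rw [← Finset.add_sum_erase _ _ ha]
  rw [Finset.sum_sub_distrib] at h1 ⊢
  rw [Finset.sum_sub_distrib]
  have h6 : (r (G a ∪ X)ᶜ : ℤ) + r X ≤ r (G a)ᶜ + r (G a ∩ X) := by
    have : r (G a ∪ X)ᶜ + r X ≤ r (G a)ᶜ + r (G a ∩ X) := by omega
    exact_mod_cast this
  have h2' : (r (G a ∩ X) : ℤ) ≤ r (X \ ⋃ u ∈ s.erase a, G u) := by exact_mod_cast h2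
  linarith

/-- All four corners of `X` and `G` are nonempty. -/
def Crosses (X G : Set α) : Prop :=
  (X ∩ G).Nonempty ∧ (X \ G).Nonempty ∧ (G \ X).Nonempty ∧ (X ∪ G)ᶜ.Nonempty

lemma crosses_compl_left {X G : Set α} : Crosses Xᶜ G ↔ Crosses X G := by
  have h1 : Xᶜ ∩ G = G \ X := by ext; simp [and_comm]
  have h2 : Xᶜ \ G = (X ∪ G)ᶜ := by ext; simp
  have h3 : G \ Xᶜ = X ∩ G := by ext; simp [and_comm]
  have h4 : (Xᶜ ∪ G)ᶜ = X \ G := by ext; simp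
  rw [Crosses, Crosses, h1, h2, h3, h4]
  tauto

lemma crosses_comm {X G : Set α} : Crosses X G ↔ Crosses G X := by
  rw [Crosses, Crosses, Set.inter_comm, Set.union_comm]
  tauto

lemma crosses_compl_right {X G : Set α} : Crosses X Gᶜ ↔ Crosses X G := by
  rw [crosses_comm, crosses_compl_left, crosses_comm]

/-- If `H` is nested with `G`, and `G` crosses `X`, then `X \ G` crosses `H` only if `X` does. -/
lemma Crosses.of_diff {X G H : Set α} (hG : Crosses X G)
    (hH : H ∩ G = ∅ ∨ H ⊆ G ∨ G ⊆ H ∨ H ∪ G = Set.univ) (h : Crosses (X \ G) H) :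
    Crosses X H := by
  obtain ⟨⟨x₁, h1⟩, ⟨x₂, h2⟩, ⟨x₃, h3⟩, ⟨x₄, h4⟩⟩ := h
  obtain ⟨-, -, ⟨y, hy⟩, -⟩ := hG
  simp only [Set.mem_inter_iff, Set.mem_sdiff, Set.mem_compl_iff, Set.mem_union] at h1 h2 h3 h4 hy
  refine ⟨⟨x₁, h1.1.1, h1.2⟩, ⟨x₂, h2.1.1, h2.2⟩, ?_⟩
  rcases hH with hH | hH | hH | hH
  · have key : ∀ z, z ∈ H → z ∉ G := fun z hz hz' => by
      simpa [hH] using (show z ∈ H ∩ G from ⟨hz, hz'⟩)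
    refine ⟨⟨x₃, h3.1, fun hx => h3.2 ⟨hx, key _ h3.1⟩⟩, ⟨y, ?_⟩⟩
    simp only [Set.mem_compl_iff, Set.mem_union, not_or]
    exact ⟨hy.2, fun hyH => key _ hyH hy.1⟩
  · exact absurd (hH h1.2) h1.1.2
  · refine ⟨⟨y, hH hy.1, hy.2⟩, ⟨x₄, ?_⟩⟩
    simp only [Set.mem_compl_iff, Set.mem_union, not_or]
    exact ⟨fun hx => h4 (.inl ⟨hx, fun hxG => h4 (.inr (hH hxG))⟩), fun hx => h4 (.inr hx)⟩
  · have : x₂ ∈ H ∪ G := hH ▸ Set.mem_univ _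
    rcases this with h | h
    · exact absurd h h2.2
    · exact absurd h h2.1.2

end RankFunctions

section Retract

variable {α W : Type*} {r : Set α → ℕ} {T : SimpleGraph W} {τ : α → W}

/-- The elements decomposed on the `u`-side of the edge `uv`. -/
def lab (T : SimpleGraph W) (τ : α → W) (u v : W) : Set α := τ ⁻¹' side T u v

lemma lab_compl (hT : T.IsTree) {u v : W} (huv : T.Adj u v) : (lab T τ u v)ᶜ = lab T τ v u := by
  rw [lab, lab, ← side_compl hT huv, Set.preimage_compl]

lemma conn_lab_comm (hT : T.IsTree) {u v : W} (huv : T.Adj u v) :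
    conn r (lab T τ u v) = conn r (lab T τ v u) := by
  rw [← lab_compl hT huv, conn_compl]

/-- The rank-width of the bag at `v`. -/
def bagSize [Fintype W] (r : Set α → ℕ) (T : SimpleGraph W) (τ : α → W) (v : W) : ℤ :=
  r Set.univ - ∑ u with T.Adj u v, ((r Set.univ : ℤ) - r (lab T τ u v)ᶜ)

/-- The number of oriented edges whose label crosses `X`. -/
def crossNum (T : SimpleGraph W) (τ : α → W) (X : Set α) : ℕ :=
  {p : W × W | T.Adj p.1 p.2 ∧ Crosses X (lab T τ p.1 p.2)}.ncard

lemma crossNum_compl (X : Set α) : crossNum T τ Xᶜ = crossNum T τ X := by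
  simp only [crossNum, crosses_compl_left]

/-- Redirect all elements of `Z` to the vertex `ρ`. -/
def retract (τ : α → W) (Z : Set α) (ρ : W) (y : α) : W := if y ∈ Z then ρ else τ y

lemma lab_retract_of_mem {Z : Set α} {ρ a b : W} (h : ρ ∈ side T a b) :
    lab T (retract τ Z ρ) a b = lab T τ a b ∪ Z := by
  ext y
  by_cases hy : y ∈ Z <;> simp [lab, retract, hy, h]

lemma lab_retract_of_notMem {Z : Set α} {ρ a b : W} (h : ρ ∉ side T a b) :
    lab T (retract τ Z ρ) a b = lab T τ a b \ Z := by
  ext y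
  by_cases hy : y ∈ Z <;> simp [lab, retract, hy, h]

/-- `Z` is a set of minimum connectivity between `lab T τ t ρ` and `Z`, and among those
crosses as few labels of the tree as possible. -/
structure IsTightLink (r : Set α → ℕ) (T : SimpleGraph W) (τ : α → W) (t ρ : W)
    (Z : Set α) : Prop where
  adj : T.Adj t ρ
  subset : lab T τ t ρ ⊆ Z
  conn_le : ∀ Y, lab T τ t ρ ⊆ Y → Y ⊆ Z → conn r Z ≤ conn r Y
  crossNum_le : ∀ Y, lab T τ t ρ ⊆ Y → Y ⊆ Z → conn r Y ≤ conn r Z →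
    crossNum T τ Z ≤ crossNum T τ Y

variable {t ρ : W} {Z : Set α}

lemma IsTightLink.lab_subset_or_disjoint (hT : T.IsTree) (h : IsTightLink r T τ t ρ Z) {a b : W}
    (hab : T.Adj a b) (hρ : ρ ∉ side T a b) :
    lab T τ a b ⊆ lab T τ t ρ ∨ Disjoint (lab T τ a b) (lab T τ t ρ) :=
  (side_subset_or_disjoint hT hab h.adj hρ).imp (fun h => Set.preimage_mono h)
    fun h => h.preimage τ

lemma IsTightLink.conn_lab_retract_le (hr : IsRankFun r) (hT : T.IsTree)
    (h : IsTightLink r T τ t ρ Z) {a b : W} (hab : T.Adj a b) :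
    conn r (lab T (retract τ Z ρ) a b) ≤ conn r (lab T τ a b) := by
  wlog hρ : ρ ∉ side T a b generalizing a b
  · rw [conn_lab_comm hT hab, conn_lab_comm hT hab]
    refine this hab.symm ?_
    rw [← side_compl hT hab]
    exact fun h => hρ h
  rw [lab_retract_of_notMem hρ]
  rcases h.lab_subset_or_disjoint hT hab hρ with h' | h'
  · rw [Set.sdiff_eq_empty.2 (h'.trans h.subset), hr.conn_empty]
    exact Nat.zero_le _
  · have h1 := hr.conn_submod (lab T τ a b)ᶜ Z
    have h2 := h.conn_le ((lab T τ a b)ᶜ ∩ Z)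
      (Set.subset_inter h'.subset_compl_left h.subset) Set.inter_subset_right
    rw [conn_compl] at h1
    rw [← conn_compl (lab T τ a b \ Z), show (lab T τ a b \ Z)ᶜ = (lab T τ a b)ᶜ ∪ Z by
      ext; simp; tauto]
    omega

lemma IsTightLink.conn_lab_retract_lt [Finite W] (hr : IsRankFun r) (hT : T.IsTree)
    (h : IsTightLink r T τ t ρ Z) {a b : W} (hab : T.Adj a b)
    (hc : Crosses Z (lab T τ a b)) :
    conn r (lab T (retract τ Z ρ) a b) < conn r (lab T τ a b) := by
  wlog hρ : ρ ∉ side T a b generalizing a b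
  · rw [conn_lab_comm hT hab, conn_lab_comm hT hab]
    refine this hab.symm ?_ ?_
    · rwa [← lab_compl hT hab, crosses_compl_right]
    · rw [← side_compl hT hab]
      exact fun h => hρ h
  rw [lab_retract_of_notMem hρ]
  by_contra hlt
  rcases h.lab_subset_or_disjoint hT hab hρ with h' | h'
  · obtain ⟨y, hy⟩ := hc.2.2.1
    exact hy.2 (h.subset (h' hy.1))
  · have h1 := hr.conn_submod (lab T τ a b)ᶜ Z
    rw [conn_compl] at h1
    rw [← conn_compl (lab T τ a b \ Z), show (lab T τ a b \ Z)ᶜ = (lab T τ a b)ᶜ ∪ Z by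
      ext; simp; tauto] at hlt
    have hZ : (lab T τ a b)ᶜ ∩ Z = Z \ lab T τ a b := by ext; simp [and_comm]
    have h2 := h.crossNum_le (Z \ lab T τ a b)
      (Set.subset_sdiff.2 ⟨h.subset, h'.symm⟩) Set.sdiff_subset (by rw [← hZ]; omega)
    refine absurd h2 (not_le.2 (Set.ncard_lt_ncard ?_ (Set.toFinite _)))
    refine ⟨fun p hp => ⟨hp.1, hc.of_diff ?_ hp.2⟩, fun hsub => ?_⟩
    · rcases (isCut_side hT hp.1).nested hT.connected hab hp.1 (isCut_side hT hab)
        with h | h | h | h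
      · left; rw [lab, lab, ← Set.preimage_inter, h, Set.preimage_empty]
      · exact .inr (.inl (Set.preimage_mono h))
      · exact .inr (.inr (.inl (Set.preimage_mono h)))
      · right; right; right; rw [lab, lab, ← Set.preimage_union, h, Set.preimage_univ]
    · obtain ⟨y, hy⟩ := (hsub (show (a, b) ∈ _ from ⟨hab, hc⟩)).2.1
      exact hy.1.2 hy.2

lemma conn_lab_retract_le_or_of_not_crosses (hr : IsRankFun r) {ρ' a b : W}
    (hc : ¬ Crosses Z (lab T τ a b)) :
    conn r (lab T (retract τ Z ρ) a b) ≤ conn r Z ∨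
      conn r (lab T (retract τ Zᶜ ρ') a b) ≤ conn r Z := by
  have huniv : conn r Set.univ = 0 := by rw [← Set.compl_empty, conn_compl, hr.conn_empty]
  have key : ∀ Y, (Y = ∅ ∨ Y = Set.univ ∨ Y = Z ∨ Y = Zᶜ) → conn r Y ≤ conn r Z := by
    rintro Y (rfl | rfl | rfl | rfl)
    · simp [hr.conn_empty]
    · simp [huniv]
    · exact le_rfl
    · exact (conn_compl _).le
  simp only [Crosses, not_and_or, Set.not_nonempty_iff_eq_empty, Set.sdiff_eq_empty] at hc
  rcases hc with h | h | h | h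
  · right
    apply key
    have h' : lab T τ a b ⊆ Zᶜ :=
      Set.subset_compl_comm.1 (Set.disjoint_iff_inter_eq_empty.2 h).subset_compl_right
    by_cases hm : ρ' ∈ side T a b
    · rw [lab_retract_of_mem hm, Set.union_eq_self_of_subset_left h']; simp
    · rw [lab_retract_of_notMem hm, Set.sdiff_eq_empty.2 h']; simp
  · right
    apply key
    by_cases hm : ρ' ∈ side T a b
    · rw [lab_retract_of_mem hm]
      right; left
      exact Set.eq_univ_of_forall fun y => (em (y ∈ Z)).imp (fun hy => h hy) id
    · rw [lab_retract_of_notMem hm, Set.sdiff_compl, Set.inter_eq_self_of_subset_right h]; simp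
  · left
    apply key
    by_cases hm : ρ ∈ side T a b
    · rw [lab_retract_of_mem hm, Set.union_eq_self_of_subset_left h]; simp
    · rw [lab_retract_of_notMem hm, Set.sdiff_eq_empty.2 h]; simp
  · left
    apply key
    rw [Set.compl_empty_iff] at h
    by_cases hm : ρ ∈ side T a b
    · rw [lab_retract_of_mem hm, Set.union_comm, h]; simp
    · rw [lab_retract_of_notMem hm]
      right; right; right
      ext y
      have : y ∈ Z ∪ lab T τ a b := h ▸ Set.mem_univ y
      simp only [Set.mem_sdiff, Set.mem_compl_iff]
      simp only [Set.mem_union] at this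
      tauto

variable [Fintype W]

lemma pairwiseDisjoint_lab (hT : T.IsTree) (v : W) :
    ((Finset.univ.filter fun u => T.Adj u v : Finset W) : Set W).PairwiseDisjoint
      fun u => lab T τ u v := by
  intro u hu u' hu' hne
  simp only [Finset.coe_filter, Finset.mem_univ, true_and, Set.mem_ofPred_eq] at hu hu'
  exact (disjoint_side_of_ne hT hu hu' hne).preimage τ

lemma IsTightLink.bagSize_retract_self_le (hr : IsRankFun r) (hT : T.IsTree)
    (h : IsTightLink r T τ t ρ Z) :
    bagSize r T (retract τ Z ρ) ρ - (r Set.univ - r Zᶜ) ≤ bagSize r T τ ρ := by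
  have ht : t ∈ Finset.univ.filter fun u => T.Adj u ρ := by simp [h.adj]
  have hX : lab T τ t ρ ∩ Z = lab T τ t ρ := Set.inter_eq_self_of_subset_left h.subset
  have h1 := hr.sum_shift_le _ _ Z (pairwiseDisjoint_lab (τ := τ) hT ρ) ht
    (h.conn_le _ (by rw [hX]) Set.inter_subset_right)
  have hlab : ∀ u ∈ Finset.univ.filter (fun u => T.Adj u ρ),
      lab T (retract τ Z ρ) u ρ = lab T τ u ρ \ Z := fun u hu =>
    lab_retract_of_notMem (isCut_side hT (by simpa using hu)).right_notMem
  rw [Set.union_eq_self_of_subset_left h.subset] at h1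
  have h2 : ∑ u with T.Adj u ρ, ((r Set.univ : ℤ) - r (lab T (retract τ Z ρ) u ρ)ᶜ) =
      ∑ u ∈ (Finset.univ.filter fun u => T.Adj u ρ).erase t,
        ((r Set.univ : ℤ) - r (lab T τ u ρ \ Z)ᶜ) := by
    rw [← Finset.add_sum_erase _ _ ht, hlab t ht, Set.sdiff_eq_empty.2 h.subset]
    simp only [Set.compl_empty, sub_self, zero_add]
    exact Finset.sum_congr rfl fun u hu => by rw [hlab u (Finset.mem_of_mem_erase hu)]
  rw [bagSize, bagSize, h2]
  linarith

lemma IsTightLink.bagSize_retract_le (hr : IsRankFun r) (hT : T.IsTree)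
    (h : IsTightLink r T τ t ρ Z) {v : W} (hv : v ≠ ρ) :
    bagSize r T (retract τ Z ρ) v ≤ max 0 (bagSize r T τ v) := by
  obtain ⟨u₀, hu₀, hρ⟩ := exists_adj_mem_side hT hv
  have hu : u₀ ∈ Finset.univ.filter fun u => T.Adj u v := by simp [hu₀]
  have hmiss : ∀ u ∈ (Finset.univ.filter fun u => T.Adj u v).erase u₀, ρ ∉ side T u v := by
    intro u hu hmem
    simp only [Finset.mem_erase, Finset.mem_filter, Finset.mem_univ, true_and] at hu
    exact Set.disjoint_left.1 (disjoint_side_of_ne hT hu.2 hu₀ hu.1) hmem hρ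
  have h2 : ∑ u with T.Adj u v, ((r Set.univ : ℤ) - r (lab T (retract τ Z ρ) u v)ᶜ) =
      (r Set.univ - r (lab T τ u₀ v ∪ Z)ᶜ) +
      ∑ u ∈ (Finset.univ.filter fun u => T.Adj u v).erase u₀,
        ((r Set.univ : ℤ) - r (lab T τ u v \ Z)ᶜ) := by
    rw [← Finset.add_sum_erase _ _ hu, lab_retract_of_mem hρ]
    congr 1
    exact Finset.sum_congr rfl fun u hu => by rw [lab_retract_of_notMem (hmiss u hu)]
  have hρ' : ρ ∉ side T v u₀ := by rw [← side_compl hT hu₀]; exact fun h => h hρ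
  rcases h.lab_subset_or_disjoint hT hu₀.symm hρ' with h' | h'
  · refine le_max_of_le_left ?_
    have huniv : lab T τ u₀ v ∪ Z = Set.univ := by
      rw [← lab_compl hT hu₀] at h'
      exact Set.eq_univ_of_forall fun y => (em (y ∈ lab T τ u₀ v)).imp id
        fun hy => h.subset (h' hy)
    rw [bagSize, h2, huniv, Set.compl_univ, hr.empty]
    have : (0 : ℤ) ≤ ∑ u ∈ (Finset.univ.filter fun u => T.Adj u v).erase u₀,
        ((r Set.univ : ℤ) - r (lab T τ u v \ Z)ᶜ) := Finset.sum_nonneg fun u _ =>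
      sub_nonneg.2 (by exact_mod_cast hr.mono _ _ (Set.subset_univ _))
    push_cast
    linarith
  · refine le_max_of_le_right ?_
    rw [← lab_compl hT hu₀] at h'
    have h1 := hr.sum_shift_le _ _ Z (pairwiseDisjoint_lab (τ := τ) hT v) hu
      (h.conn_le _ (Set.subset_inter (by simpa using h'.subset_compl_left) h.subset)
        Set.inter_subset_right)
    rw [bagSize, bagSize, h2]
    linarith

end Retract


section Join

variable {α W W' : Type*} {T : SimpleGraph W} {τ : α → W} {ρ : Bool → W} {φ : W' ≃ W × Bool}

/-- Two copies of `T`, joined by an edge between the copies of `ρ false` and `ρ true`. -/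
def joinGraph (T : SimpleGraph W) (ρ : Bool → W) (φ : W' ≃ W × Bool) : SimpleGraph W' where
  Adj x y := ((φ x).2 = (φ y).2 ∧ T.Adj (φ x).1 (φ y).1) ∨
    ((φ x).2 ≠ (φ y).2 ∧ (φ x).1 = ρ (φ x).2 ∧ (φ y).1 = ρ (φ y).2)
  symm := ⟨fun _ _ h => h.imp (fun h => ⟨h.1.symm, h.2.symm⟩) fun h => ⟨h.1.symm, h.2.2, h.2.1⟩⟩
  loopless := ⟨fun _ h => h.elim (fun h => h.2.ne rfl) fun h => h.1 rfl⟩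

lemma joinGraph_adj_copy {a b : W} (i : Bool) (hab : T.Adj a b) :
    (joinGraph T ρ φ).Adj (φ.symm (a, i)) (φ.symm (b, i)) := by
  left
  simpa using hab

lemma joinGraph_adj_link {i j : Bool} (hij : i ≠ j) :
    (joinGraph T ρ φ).Adj (φ.symm (ρ i, i)) (φ.symm (ρ j, j)) := by
  right
  simpa using hij

lemma joinGraph_connected (hT : T.Connected) : (joinGraph T ρ φ).Connected := by
  have copy : ∀ (i : Bool) (a b : W),
      (joinGraph T ρ φ).Reachable (φ.symm (a, i)) (φ.symm (b, i)) := fun i a b =>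
    (hT.preconnected a b).map (⟨fun a => φ.symm (a, i), joinGraph_adj_copy i⟩ :
      T →g joinGraph T ρ φ)
  have hpre : (joinGraph T ρ φ).Preconnected := by
    intro x y
    obtain ⟨⟨a, i⟩, rfl⟩ := φ.symm.surjective x
    obtain ⟨⟨b, j⟩, rfl⟩ := φ.symm.surjective y
    by_cases hij : i = j
    · subst hij
      exact copy i a b
    · exact ((copy i a (ρ i)).trans (joinGraph_adj_link hij).reachable).trans (copy j (ρ j) b)
  obtain ⟨a⟩ := hT.nonempty
  have : Nonempty W' := ⟨φ.symm (a, false)⟩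
  exact ⟨hpre⟩

lemma isCut_joinGraph_copy (hT : T.IsTree) {a b : W} (i : Bool) (hab : T.Adj a b) :
    IsCut (joinGraph T ρ φ) (φ.symm (a, i)) (φ.symm (b, i))
      {x | (if (φ x).2 = i then (φ x).1 else ρ i) ∈ side T a b} := by
  have c := isCut_side hT hab
  refine ⟨by simpa using c.left_mem, by simpa using c.right_notMem, fun x y hxy hx hy => ?_⟩
  obtain ⟨⟨p, j⟩, rfl⟩ := φ.symm.surjective x
  obtain ⟨⟨q, l⟩, rfl⟩ := φ.symm.surjective y
  simp only [joinGraph, Equiv.apply_symm_apply, Set.mem_ofPred_eq] at hxy hx hy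
  rcases hxy with ⟨rfl, h⟩ | ⟨hne, rfl, rfl⟩
  · by_cases hj : j = i
    · subst hj
      rw [if_pos rfl] at hx hy
      obtain ⟨rfl, rfl⟩ := c.eq_of_adj p q h hx hy
      exact ⟨rfl, rfl⟩
    · rw [if_neg hj] at hx hy
      exact absurd hx hy
  · by_cases hj : j = i
    · subst hj
      rw [if_pos rfl] at hx
      rw [if_neg hne.symm] at hy
      exact absurd hx hy
    · have hl : l = i := by cases i <;> cases j <;> cases l <;> simp_all
      subst hl
      rw [if_neg hj] at hx
      rw [if_pos rfl] at hy
      exact absurd hx hy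

lemma isCut_joinGraph_link {i j : Bool} (hij : i ≠ j) :
    IsCut (joinGraph T ρ φ) (φ.symm (ρ j, j)) (φ.symm (ρ i, i)) {x | (φ x).2 ≠ i} := by
  refine ⟨by simpa using hij.symm, by simp, fun x y hxy hx hy => ?_⟩
  obtain ⟨⟨p, l⟩, rfl⟩ := φ.symm.surjective x
  obtain ⟨⟨q, m⟩, rfl⟩ := φ.symm.surjective y
  simp only [joinGraph, Equiv.apply_symm_apply, Set.mem_ofPred_eq, not_not] at hxy hx hy
  subst hy
  obtain rfl : l = j := by cases m <;> cases j <;> cases l <;> simp_all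
  rcases hxy with ⟨h, -⟩ | ⟨-, rfl, rfl⟩
  · exact absurd h hx
  · exact ⟨rfl, rfl⟩

/-- Every edge of a join is a copy of an edge or the edge between the copies. -/
lemma joinGraph_adj_cases {x y : W'} (h : (joinGraph T ρ φ).Adj x y) :
    (∃ a b i, T.Adj a b ∧ x = φ.symm (a, i) ∧ y = φ.symm (b, i)) ∨
      ∃ i j, i ≠ j ∧ x = φ.symm (ρ j, j) ∧ y = φ.symm (ρ i, i) := by
  obtain ⟨⟨p, l⟩, rfl⟩ := φ.symm.surjective x
  obtain ⟨⟨q, m⟩, rfl⟩ := φ.symm.surjective y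
  simp only [joinGraph, Equiv.apply_symm_apply] at h
  rcases h with ⟨rfl, h⟩ | ⟨h, rfl, rfl⟩
  · exact .inl ⟨p, q, l, h, rfl, rfl⟩
  · exact .inr ⟨m, l, h.symm, rfl, rfl⟩

lemma isTree_joinGraph (hT : T.IsTree) : (joinGraph T ρ φ).IsTree := by
  refine isTree_of_isCut (joinGraph_connected hT.connected) fun u v huv => ?_
  rcases joinGraph_adj_cases huv with ⟨a, b, i, h, rfl, rfl⟩ | ⟨i, j, h, rfl, rfl⟩
  · exact ⟨_, isCut_joinGraph_copy hT i h⟩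
  · exact ⟨_, isCut_joinGraph_link h⟩

/-- Place every element at the copy of its old vertex selected by `c`. -/
def joinMap (τ : α → W) (φ : W' ≃ W × Bool) (c : α → Bool) (y : α) : W' := φ.symm (τ y, c y)

variable {c : α → Bool}

lemma lab_joinGraph_copy (hT : T.IsTree) {a b : W} (i : Bool) (hab : T.Adj a b) :
    lab (joinGraph T ρ φ) (joinMap τ φ c) (φ.symm (a, i)) (φ.symm (b, i)) =
      lab T (retract τ {y | c y ≠ i} (ρ i)) a b := by
  rw [lab, ← (isCut_joinGraph_copy hT i hab).eq_side (joinGraph_connected hT.connected)]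
  ext y
  by_cases h : c y = i <;> simp [joinMap, lab, retract, h]

lemma lab_joinGraph_link (hT : T.Connected) {i j : Bool} (hij : i ≠ j) :
    lab (joinGraph T ρ φ) (joinMap τ φ c) (φ.symm (ρ j, j)) (φ.symm (ρ i, i)) =
      {y | c y ≠ i} := by
  rw [lab, ← (isCut_joinGraph_link hij).eq_side (joinGraph_connected hT)]
  ext y
  simp [joinMap]

lemma bagSize_joinGraph [Fintype W] [Fintype W'] {r : Set α → ℕ} (hT : T.IsTree) (v : W)
    (i : Bool) :
    bagSize r (joinGraph T ρ φ) (joinMap τ φ c) (φ.symm (v, i)) =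
      bagSize r T (retract τ {y | c y ≠ i} (ρ i)) v -
        if v = ρ i then (r Set.univ : ℤ) - r {y | c y ≠ i}ᶜ else 0 := by
  have hi : (!i) ≠ i := by simp
  rw [bagSize, bagSize, Finset.sum_filter, ← Equiv.sum_comp φ.symm, Fintype.sum_prod_type_right,
    ← Finset.sum_erase_add _ _ (Finset.mem_univ i), add_comm,
    show (Finset.univ.erase i : Finset Bool) = {!i} by cases i <;> rfl, Finset.sum_singleton]
  have h1 : ∀ u, (if (joinGraph T ρ φ).Adj (φ.symm (u, i)) (φ.symm (v, i)) then
        ((r Set.univ : ℤ) - r (lab (joinGraph T ρ φ) (joinMap τ φ c)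
          (φ.symm (u, i)) (φ.symm (v, i)))ᶜ) else 0) =
      if T.Adj u v then
        ((r Set.univ : ℤ) - r (lab T (retract τ {y | c y ≠ i} (ρ i)) u v)ᶜ) else 0 := by
    intro u
    by_cases h : T.Adj u v
    · rw [if_pos h, if_pos (joinGraph_adj_copy i h), lab_joinGraph_copy hT i h]
    · rw [if_neg h, if_neg]
      simpa [joinGraph] using h
  have h2 : ∀ u, (if (joinGraph T ρ φ).Adj (φ.symm (u, !i)) (φ.symm (v, i)) then
        ((r Set.univ : ℤ) - r (lab (joinGraph T ρ φ) (joinMap τ φ c)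
          (φ.symm (u, !i)) (φ.symm (v, i)))ᶜ) else 0) =
      if u = ρ !i then (if v = ρ i then (r Set.univ : ℤ) - r {y | c y ≠ i}ᶜ else 0) else 0 := by
    intro u
    have hadj : (joinGraph T ρ φ).Adj (φ.symm (u, !i)) (φ.symm (v, i)) ↔
        u = ρ (!i) ∧ v = ρ i := by simp [joinGraph]
    by_cases hu : u = ρ !i
    · by_cases hv : v = ρ i
      · rw [if_pos (hadj.2 ⟨hu, hv⟩), if_pos hu, if_pos hv, hu, hv,
          lab_joinGraph_link hT.connected hi.symm]
      · rw [if_neg fun h => hv (hadj.1 h).2, if_pos hu, if_neg hv]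
    · rw [if_neg fun h => hu (hadj.1 h).1, if_neg hu]
  rw [Finset.sum_congr rfl fun u _ => h1 u, Finset.sum_congr rfl fun u _ => h2 u,
    ← Finset.sum_filter, Finset.sum_ite_eq' Finset.univ, if_pos (Finset.mem_univ _)]
  ring

end Join

section Potential

variable {α W W' : Type*} {r : Set α → ℕ} {T : SimpleGraph W} {τ : α → W} {ρ : Bool → W}
  {φ : W' ≃ W × Bool} {c : α → Bool} {s : ℕ}

/-- Adjacency along tree edges of connectivity at least `s`. -/
def Heavy (r : Set α → ℕ) (T : SimpleGraph W) (τ : α → W) (s : ℕ) (a b : W) : Prop :=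
  T.Adj a b ∧ s ≤ conn r (lab T τ a b)

/-- The pairs of oriented edges joined by a walk of edges of connectivity at least `s`. -/
def heavyPairs (r : Set α → ℕ) (T : SimpleGraph W) (τ : α → W) (s : ℕ) :
    Set ((W × W) × W × W) :=
  {q | Heavy r T τ s q.1.1 q.1.2 ∧ Heavy r T τ s q.2.1 q.2.2 ∧
    Relation.ReflTransGen (Heavy r T τ s) q.1.1 q.2.2}

lemma conn_ne_eq (i : Bool) : conn r {y | c y ≠ i} = conn r {y | c y ≠ false} := by
  cases i
  · rfl
  · rw [← conn_compl]
    congr 1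
    ext y
    simp

lemma Heavy.exists_copy (hT : T.IsTree) (hs : conn r {y | c y ≠ false} < s) {x y : W'}
    (h : Heavy r (joinGraph T ρ φ) (joinMap τ φ c) s x y) :
    ∃ a b i, T.Adj a b ∧ x = φ.symm (a, i) ∧ y = φ.symm (b, i) ∧
      s ≤ conn r (lab T (retract τ {y | c y ≠ i} (ρ i)) a b) := by
  rcases joinGraph_adj_cases h.1 with ⟨a, b, i, hab, rfl, rfl⟩ | ⟨i, j, hij, rfl, rfl⟩
  · refine ⟨a, b, i, hab, rfl, rfl, ?_⟩
    rw [← lab_joinGraph_copy (φ := φ) hT i hab]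
    exact h.2
  · have := h.2
    rw [lab_joinGraph_link hT.connected hij, conn_ne_eq] at this
    omega

/-- Forget the copies in a pair of oriented edges of a join. -/
def projPair (φ : W' ≃ W × Bool) (q : (W' × W') × W' × W') : (W × W) × W × W :=
  (((φ q.1.1).1, (φ q.1.2).1), ((φ q.2.1).1, (φ q.2.2).1))

lemma exists_copy_of_mem_heavyPairs (hT : T.IsTree) (hs : conn r {y | c y ≠ false} < s)
    {q : (W' × W') × W' × W'}
    (hq : q ∈ heavyPairs r (joinGraph T ρ φ) (joinMap τ φ c) s) :
    ∃ a b d e i, q = ((φ.symm (a, i), φ.symm (b, i)), (φ.symm (d, i), φ.symm (e, i))) ∧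
      s ≤ conn r (lab T (retract τ {y | c y ≠ i} (ρ i)) a b) ∧
      s ≤ conn r (lab T (retract τ {y | c y ≠ i} (ρ i)) d e) ∧ T.Adj a b := by
  obtain ⟨⟨x, x'⟩, y, y'⟩ := q
  obtain ⟨h1, h2, h3⟩ := hq
  simp only at h1 h2 h3
  have hidx : (φ x).2 = (φ y').2 := by
    clear h1 h2
    induction h3 with
    | refl => rfl
    | tail _ h ih =>
      obtain ⟨a, b, i, -, rfl, rfl, -⟩ := h.exists_copy hT hs
      rw [ih]
      simp
  obtain ⟨a, b, i, hab, rfl, rfl, h⟩ := h1.exists_copy hT hs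
  obtain ⟨d, e, j, -, rfl, rfl, h'⟩ := h2.exists_copy hT hs
  obtain rfl : i = j := by simpa using hidx
  exact ⟨a, b, d, e, i, rfl, h, h', hab⟩

variable {t : Bool → W}

lemma mapsTo_projPair (hr : IsRankFun r) (hT : T.IsTree)
    (hl : ∀ i, IsTightLink r T τ (t i) (ρ i) {y | c y ≠ i})
    (hs : conn r {y | c y ≠ false} < s) :
    Set.MapsTo (projPair φ) (heavyPairs r (joinGraph T ρ φ) (joinMap τ φ c) s)
      (heavyPairs r T τ s) := by
  have key : ∀ x y, Heavy r (joinGraph T ρ φ) (joinMap τ φ c) s x y →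
      Heavy r T τ s (φ x).1 (φ y).1 := by
    intro x y h
    obtain ⟨a, b, i, hab, rfl, rfl, h'⟩ := h.exists_copy hT hs
    rw [Equiv.apply_symm_apply, Equiv.apply_symm_apply]
    exact ⟨hab, h'.trans ((hl i).conn_lab_retract_le hr hT hab)⟩
  exact fun q hq => ⟨key _ _ hq.1, key _ _ hq.2.1, hq.2.2.lift (fun x => (φ x).1) key⟩

lemma injOn_projPair (hT : T.IsTree) (hs : conn r {y | c y ≠ false} < s)
    (hlight : ∀ a b, T.Adj a b →
      ∃ i, conn r (lab T (retract τ {y | c y ≠ i} (ρ i)) a b) < s) :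
    Set.InjOn (projPair φ) (heavyPairs r (joinGraph T ρ φ) (joinMap τ φ c) s) := by
  intro q hq q' hq' heq
  obtain ⟨a, b, d, e, i, rfl, h1, -, hab⟩ := exists_copy_of_mem_heavyPairs hT hs hq
  obtain ⟨a', b', d', e', j, rfl, h2, -, -⟩ := exists_copy_of_mem_heavyPairs hT hs hq'
  simp only [projPair, Equiv.apply_symm_apply, Prod.mk.injEq] at heq
  obtain ⟨⟨rfl, rfl⟩, rfl, rfl⟩ := heq
  suffices i = j by rw [this]
  by_contra hij
  obtain ⟨l, hl⟩ := hlight a b hab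
  have : l = i ∨ l = j := by cases i <;> cases j <;> cases l <;> simp_all
  rcases this with rfl | rfl <;> omega

lemma ncard_heavyPairs_joinGraph_le [Finite W] (hr : IsRankFun r) (hT : T.IsTree)
    (hl : ∀ i, IsTightLink r T τ (t i) (ρ i) {y | c y ≠ i})
    (hs : conn r {y | c y ≠ false} < s)
    (hlight : ∀ a b, T.Adj a b →
      ∃ i, conn r (lab T (retract τ {y | c y ≠ i} (ρ i)) a b) < s) :
    (heavyPairs r (joinGraph T ρ φ) (joinMap τ φ c) s).ncard ≤ (heavyPairs r T τ s).ncard :=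
  Set.ncard_le_ncard_of_injOn _ (mapsTo_projPair hr hT hl hs) (injOn_projPair hT hs hlight)
    (Set.toFinite _)

lemma ncard_heavyPairs_joinGraph_lt [Finite W] (hr : IsRankFun r) (hT : T.IsTree)
    (hl : ∀ i, IsTightLink r T τ (t i) (ρ i) {y | c y ≠ i})
    (hs : conn r {y | c y ≠ false} < s)
    (hlight : ∀ a b, T.Adj a b →
      ∃ i, conn r (lab T (retract τ {y | c y ≠ i} (ρ i)) a b) < s)
    {a b d e : W} (hq : ((a, b), (d, e)) ∈ heavyPairs r T τ s)
    (hlost : ∀ i, conn r (lab T (retract τ {y | c y ≠ i} (ρ i)) a b) < s ∨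
      conn r (lab T (retract τ {y | c y ≠ i} (ρ i)) d e) < s) :
    (heavyPairs r (joinGraph T ρ φ) (joinMap τ φ c) s).ncard < (heavyPairs r T τ s).ncard := by
  rw [← (injOn_projPair hT hs hlight).ncard_image]
  refine Set.ncard_lt_ncard ⟨(mapsTo_projPair hr hT hl hs).image_subset, fun hsub => ?_⟩
    (Set.toFinite _)
  obtain ⟨q, hq, heq⟩ := hsub hq
  obtain ⟨a', b', d', e', i, rfl, h1, h2, -⟩ := exists_copy_of_mem_heavyPairs hT hs hq
  simp only [projPair, Equiv.apply_symm_apply, Prod.mk.injEq] at heq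
  obtain ⟨⟨rfl, rfl⟩, rfl, rfl⟩ := heq
  rcases hlost i with h | h <;> omega

/-- If `t false, ρ false` and `ρ true, t true` are joined by a walk of edges of connectivity
exceeding that of the link, then the join has fewer heavy pairs, from some threshold on. -/
lemma exists_heavyPairs_joinGraph_lt [Finite W] (hr : IsRankFun r) (hT : T.IsTree)
    (hl : ∀ i, IsTightLink r T τ (t i) (ρ i) {y | c y ≠ i})
    (hq : ((t false, ρ false), (ρ true, t true)) ∈
      heavyPairs r T τ (conn r {y | c y ≠ false} + 1)) :
    ∃ s, (heavyPairs r (joinGraph T ρ φ) (joinMap τ φ c) s).ncard < (heavyPairs r T τ s).ncard ∧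
      ∀ s' ≥ s, (heavyPairs r (joinGraph T ρ φ) (joinMap τ φ c) s').ncard ≤
        (heavyPairs r T τ s').ncard := by
  set k := conn r {y | c y ≠ false} with hk
  have hcompl : {y | c y ≠ true} = {y | c y ≠ false}ᶜ := by ext y; simp
  have hcross : ∀ i G, Crosses {y | c y ≠ false} G → Crosses {y | c y ≠ i} G := by
    rintro (_ | _) G h
    · exact h
    · rwa [hcompl, crosses_compl_left]
  have hlt : ∀ i a b, T.Adj a b → Crosses {y | c y ≠ false} (lab T τ a b) →
      conn r (lab T (retract τ {y | c y ≠ i} (ρ i)) a b) < conn r (lab T τ a b) :=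
    fun i a b hab h => (hl i).conn_lab_retract_lt hr hT hab (hcross i _ h)
  have hlight : ∀ s > k, (∀ a b, T.Adj a b → Crosses {y | c y ≠ false} (lab T τ a b) →
      conn r (lab T τ a b) ≤ s) → ∀ a b, T.Adj a b →
      ∃ i, conn r (lab T (retract τ {y | c y ≠ i} (ρ i)) a b) < s := by
    intro s hs hmax a b hab
    by_cases hc : Crosses {y | c y ≠ false} (lab T τ a b)
    · exact ⟨false, (hlt _ a b hab hc).trans_le (hmax a b hab hc)⟩
    · rcases conn_lab_retract_le_or_of_not_crosses (ρ := ρ false) (ρ' := ρ true) hr hc with h | h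
      · exact ⟨false, by omega⟩
      · exact ⟨true, by rw [hcompl]; omega⟩
  by_cases hex : ∃ p : W × W, (T.Adj p.1 p.2 ∧ Crosses {y | c y ≠ false} (lab T τ p.1 p.2)) ∧
      k < conn r (lab T τ p.1 p.2)
  · obtain ⟨⟨a, b⟩, ⟨⟨hab, hc⟩, hgt⟩, hmax⟩ := Set.exists_max_image
      {p : W × W | (T.Adj p.1 p.2 ∧ Crosses {y | c y ≠ false} (lab T τ p.1 p.2)) ∧
        k < conn r (lab T τ p.1 p.2)} (fun p => conn r (lab T τ p.1 p.2)) (Set.toFinite _) hex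
    simp only at hab hc hgt hmax
    have hmax' : ∀ s ≥ conn r (lab T τ a b), ∀ a b, T.Adj a b →
        Crosses {y | c y ≠ false} (lab T τ a b) → conn r (lab T τ a b) ≤ s := by
      intro s hs a' b' hab' hc'
      by_cases h : k < conn r (lab T τ a' b')
      · exact (hmax (a', b') ⟨⟨hab', hc'⟩, h⟩).trans hs
      · omega
    refine ⟨conn r (lab T τ a b), ncard_heavyPairs_joinGraph_lt hr hT hl hgt
      (hlight _ hgt (hmax' _ le_rfl)) (a := a) (b := b) (d := a) (e := b)
      ⟨⟨hab, le_rfl⟩, ⟨hab, le_rfl⟩, .single ⟨hab, le_rfl⟩⟩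
      fun i => .inl (hlt i a b hab hc), fun s hs => ?_⟩
    have hs' : k < s := by omega
    exact ncard_heavyPairs_joinGraph_le hr hT hl hs' (hlight s hs' (hmax' s hs))
  · have hmax : ∀ s > k, ∀ a b, T.Adj a b →
        Crosses {y | c y ≠ false} (lab T τ a b) → conn r (lab T τ a b) ≤ s := by
      intro s hs a b hab hc
      by_contra h
      exact hex ⟨(a, b), ⟨hab, hc⟩, by simp only; omega⟩
    have hzero : ∀ i, conn r (lab T (retract τ {y | c y ≠ i} (ρ i)) (t i) (ρ i)) = 0 := by
      intro i
      rw [lab_retract_of_notMem (isCut_side hT (hl i).adj).right_notMem,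
        Set.sdiff_eq_empty.2 (hl i).subset, hr.conn_empty]
    refine ⟨k + 1, ncard_heavyPairs_joinGraph_lt hr hT hl (by omega)
      (hlight _ (by omega) (hmax _ (by omega))) hq ?_, fun s hs => ?_⟩
    · rintro (_ | _)
      · left; rw [hzero]; omega
      · right; rw [← conn_lab_comm hT (hl true).adj, hzero]; omega
    · have hs' : k < s := by omega
      exact ncard_heavyPairs_joinGraph_le hr hT hl hs' (hlight s hs' (hmax s hs'))

lemma bagSize_joinGraph_le [Fintype W] [Fintype W'] (hr : IsRankFun r) (hT : T.IsTree)
    (hl : ∀ i, IsTightLink r T τ (t i) (ρ i) {y | c y ≠ i}) {w : ℕ}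
    (hw : ∀ v, bagSize r T τ v ≤ w) (x : W') :
    bagSize r (joinGraph T ρ φ) (joinMap τ φ c) x ≤ w := by
  obtain ⟨⟨v, i⟩, rfl⟩ := φ.symm.surjective x
  rw [bagSize_joinGraph hT]
  split_ifs with h
  · rw [h]
    exact ((hl i).bagSize_retract_self_le hr hT).trans (hw _)
  · rw [sub_zero]
    exact ((hl i).bagSize_retract_le hr hT h).trans (max_le (Int.natCast_nonneg w) (hw v))

end Potential

section Linked

variable {α W : Type*} {r : Set α → ℕ} {T : SimpleGraph W} {τ : α → W}

lemma reflTransGen_of_forall_mem_darts {R : W → W → Prop} {x y : W} (p : T.Walk x y)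
    (h : ∀ d ∈ p.darts, R d.toProd.1 d.toProd.2) : Relation.ReflTransGen R x y := by
  induction p with
  | nil => exact .refl
  | cons hadj q ih =>
    rw [SimpleGraph.Walk.darts_cons] at h
    exact .head (h ⟨(_, _), hadj⟩ (by simp)) (ih fun d hd => h d (List.mem_cons_of_mem _ hd))

/-- The labels attain, between any two of them, the minimum connectivity of a set in between. -/
def IsLinkedLab (r : Set α → ℕ) (T : SimpleGraph W) (τ : α → W) : Prop :=
  ∀ e f : T.Dart, dartLE T e f →
    sInf ((fun g : T.Dart => conn r (lab T τ g.toProd.1 g.toProd.2)) ''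
        {g | dartLE T e g ∧ dartLE T g f}) =
      sInf (conn r '' {X | lab T τ e.toProd.1 e.toProd.2 ⊆ X ∧ X ⊆ lab T τ f.toProd.1 f.toProd.2})

lemma exists_isTightLink_of_not_isLinkedLab (hT : T.IsTree)
    (h : ¬ IsLinkedLab r T τ) :
    ∃ (t ρ : Bool → W) (c : α → Bool), (∀ i, IsTightLink r T τ (t i) (ρ i) {y | c y ≠ i}) ∧
      ((t false, ρ false), (ρ true, t true)) ∈
        heavyPairs r T τ (conn r {y | c y ≠ false} + 1) := by
  simp only [IsLinkedLab, not_forall] at h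
  obtain ⟨e, f, hef, hne⟩ := h
  set A := lab T τ e.toProd.1 e.toProd.2 with hA
  set D := lab T τ f.toProd.1 f.toProd.2 with hD
  have hAD : A ⊆ D := Set.preimage_mono (side_subset_of_dartLE hT hef)
  set k := sInf (conn r '' {X | A ⊆ X ∧ X ⊆ D}) with hk
  have hk_le : ∀ X, A ⊆ X → X ⊆ D → k ≤ conn r X := fun X h1 h2 => Nat.sInf_le ⟨X, ⟨h1, h2⟩, rfl⟩
  have hgt : ∀ g : T.Dart, dartLE T e g → dartLE T g f →
      k < conn r (lab T τ g.toProd.1 g.toProd.2) := by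
    have hle : k ≤ sInf ((fun g : T.Dart => conn r (lab T τ g.toProd.1 g.toProd.2)) ''
        {g | dartLE T e g ∧ dartLE T g f}) := by
      obtain ⟨g, ⟨h1, h2⟩, hg⟩ := Nat.sInf_mem (Set.Nonempty.image
        (fun g : T.Dart => conn r (lab T τ g.toProd.1 g.toProd.2))
        (⟨e, dartLE_refl hT e, hef⟩ : {g | dartLE T e g ∧ dartLE T g f}.Nonempty))
      rw [← hg]
      exact hk_le _ (Set.preimage_mono (side_subset_of_dartLE hT h1))
        (Set.preimage_mono (side_subset_of_dartLE hT h2))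
    exact fun g h1 h2 => (lt_of_le_of_ne hle (Ne.symm hne)).trans_le
      (Nat.sInf_le ⟨g, ⟨h1, h2⟩, rfl⟩)
  obtain ⟨X₀, hX₀, hkX₀⟩ : k ∈ conn r '' {X | A ⊆ X ∧ X ⊆ D} :=
    Nat.sInf_mem (Set.Nonempty.image _ ⟨A, subset_rfl, hAD⟩)
  obtain ⟨X, ⟨⟨hAX, hXD⟩, hkX⟩, hX⟩ :=
    Nat.sInf_mem (s := crossNum T τ '' {X | (A ⊆ X ∧ X ⊆ D) ∧ conn r X = k})
      ⟨_, X₀, ⟨hX₀, hkX₀⟩, rfl⟩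
  have hmin : ∀ Y, A ⊆ Y → Y ⊆ D → conn r Y ≤ k → crossNum T τ X ≤ crossNum T τ Y :=
    fun Y h1 h2 h3 => hX ▸ Nat.sInf_le ⟨Y, ⟨⟨h1, h2⟩, h3.antisymm (hk_le Y h1 h2)⟩, rfl⟩
  have hDc : lab T τ f.toProd.2 f.toProd.1 = Dᶜ := (lab_compl hT f.adj).symm
  refine ⟨fun i => if i then f.toProd.2 else e.toProd.1,
    fun i => if i then f.toProd.1 else e.toProd.2, fun y => decide (y ∈ X), ?_, ?_⟩
  · rintro (_ | _)
    · have hXf : {y | decide (y ∈ X) ≠ false} = X := by ext; simp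
      simp only [Bool.false_eq_true, if_false, hXf]
      exact ⟨e.adj, hAX, fun Y h1 h2 => hkX ▸ hk_le Y h1 (h2.trans hXD),
        fun Y h1 h2 h3 => hmin Y h1 (h2.trans hXD) (hkX ▸ h3)⟩
    · have hXt : {y | decide (y ∈ X) ≠ true} = Xᶜ := by ext; simp
      simp only [if_true, hXt]
      refine ⟨f.adj.symm, hDc ▸ Set.compl_subset_compl.2 hXD, fun Y h1 h2 => ?_,
        fun Y h1 h2 h3 => ?_⟩ <;> rw [hDc] at h1
      · rw [conn_compl, hkX, ← conn_compl Y]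
        exact hk_le _ (hAX.trans (Set.subset_compl_comm.1 h2)) (Set.compl_subset_comm.1 h1)
      · rw [crossNum_compl, ← crossNum_compl Y]
        refine hmin _ (hAX.trans (Set.subset_compl_comm.1 h2)) (Set.compl_subset_comm.1 h1) ?_
        rwa [conn_compl, ← hkX, ← conn_compl X]
  · have hXf : {y | decide (y ∈ X) ≠ false} = X := by ext; simp
    simp only [Bool.false_eq_true, if_false, if_true, hXf, hkX]
    obtain ⟨p, hp⟩ := hT.connected.exists_isPath e.toProd.1 f.toProd.2
    refine ⟨⟨e.adj, hgt e (dartLE_refl hT e) hef⟩, ⟨f.adj, hgt f hef (dartLE_refl hT f)⟩,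
      reflTransGen_of_forall_mem_darts p fun d hd => ⟨d.adj, ?_⟩⟩
    have := dartLE_of_mem_darts hT hef hp hd
    exact hgt d this.1 this.2

lemma conn_le (hr : IsRankFun r) (X : Set α) : conn r X ≤ 2 * r Set.univ := by
  have h1 := hr.mono X _ (Set.subset_univ _)
  have h2 := hr.mono Xᶜ _ (Set.subset_univ _)
  unfold conn
  omega

lemma heavyPairs_eq_empty (hr : IsRankFun r) {s : ℕ} (hs : 2 * r Set.univ < s) :
    heavyPairs r T τ s = ∅ :=
  Set.eq_empty_of_forall_notMem fun _ hq => (hs.trans_le hq.1.2).not_ge (conn_le hr _)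

lemma lex_of_lt_of_forall_le {N s : ℕ} {f g : ℕ → ℕ} (hs : s ≤ N) (hlt : f s < g s)
    (hle : ∀ s' ≥ s, f s' ≤ g s') :
    Pi.Lex (· > ·) (· < ·) (fun i : Fin (N + 1) => f i) fun i => g i := by
  obtain ⟨m, ⟨hsm, hm⟩, hmax⟩ := Set.exists_max_image
    {i : Fin (N + 1) | s ≤ i ∧ f i < g i} id (Set.toFinite _)
    ⟨⟨s, by omega⟩, le_rfl, hlt⟩
  refine ⟨m, fun j hj => ?_, hm⟩
  have hsj : s ≤ j := hsm.trans hj.le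
  by_contra hne
  exact (hmax j ⟨hsj, lt_of_le_of_ne (hle _ hsj) hne⟩).not_gt hj

/-- A tree-decomposition with respect to `r` can be made linked without increasing its width. -/
theorem exists_isLinkedLab (hr : IsRankFun r) {w n : ℕ} {T : SimpleGraph (Fin n)}
    {τ : α → Fin n} (hT : T.IsTree) (hw : ∀ v, bagSize r T τ v ≤ w) :
    ∃ (m : ℕ) (T' : SimpleGraph (Fin m)) (τ' : α → Fin m),
      T'.IsTree ∧ (∀ v, bagSize r T' τ' v ≤ w) ∧ IsLinkedLab r T' τ' := by
  let potential (x : Σ m, SimpleGraph (Fin m) × (α → Fin m)) (i : Fin (2 * r Set.univ + 1)) : ℕ :=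
    (heavyPairs r x.2.1 x.2.2 i).ncard
  have hwf := InvImage.wf potential
    (Pi.Lex.wellFounded (· > ·) fun _ => (wellFounded_lt : WellFounded ((· < ·) : ℕ → ℕ → Prop)))
  obtain ⟨⟨m, T', τ'⟩, ⟨hT', hw'⟩, hmin⟩ := hwf.has_min
    {x | x.2.1.IsTree ∧ ∀ v, bagSize r x.2.1 x.2.2 v ≤ w} ⟨⟨n, T, τ⟩, hT, hw⟩
  refine ⟨m, T', τ', hT', hw', ?_⟩
  by_contra hlink
  obtain ⟨t, ρ, c, hl, hq⟩ := exists_isTightLink_of_not_isLinkedLab hT' hlink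
  let φ : Fin (Fintype.card (Fin m × Bool)) ≃ Fin m × Bool := (Fintype.equivFin _).symm
  obtain ⟨s, hlt, hle⟩ := exists_heavyPairs_joinGraph_lt (φ := φ) hr hT' hl hq
  have hs : s ≤ 2 * r Set.univ := by
    by_contra hs
    rw [heavyPairs_eq_empty hr (not_le.1 hs), heavyPairs_eq_empty hr (not_le.1 hs)] at hlt
    simp at hlt
  exact hmin ⟨_, joinGraph T' ρ φ, joinMap τ' φ c⟩
    ⟨isTree_joinGraph hT', bagSize_joinGraph_le hr hT' hl hw'⟩ (lex_of_lt_of_forall_le hs hlt hle)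

end Linked

section Matroid

variable {α : Type*}

lemma mRank_eq [Fintype α] (M : Matroid α) (X : Set α) : mRank M X = (M.eRk X).toNat := by
  have hmem : (M.eRk X).toNat ∈ {k | ∃ I, I ⊆ X ∧ M.Indep I ∧ I.ncard = k} := by
    obtain ⟨I, hI⟩ := M.exists_isBasis' X
    exact ⟨I, hI.subset, hI.indep, by rw [← hI.encard_eq_eRk, Set.ncard]⟩
  have hub : ∀ k ∈ {k | ∃ I, I ⊆ X ∧ M.Indep I ∧ I.ncard = k}, k ≤ (M.eRk X).toNat := by
    rintro k ⟨I, hIX, hI, rfl⟩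
    refine ENat.toNat_le_toNat ?_ ?_
    · rw [← hI.eRk_eq_encard]
      exact M.eRk_mono hIX
    · exact ((M.eRk_le_encard X).trans_lt (Set.toFinite X).encard_lt_top).ne
  exact le_antisymm (csSup_le ⟨_, hmem⟩ hub) (le_csSup ⟨_, hub⟩ hmem)

lemma natCast_mRank [Fintype α] (M : Matroid α) (X : Set α) : (mRank M X : ℕ∞) = M.eRk X := by
  rw [mRank_eq]
  exact ENat.natCast_toNat ((M.eRk_le_encard X).trans_lt (Set.toFinite X).encard_lt_top).ne

lemma isRankFun_mRank [Fintype α] (M : Matroid α) : IsRankFun (mRank M) where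
  empty := by simp [mRank_eq]
  mono X Y h := by
    have := M.eRk_mono h
    rw [← natCast_mRank, ← natCast_mRank] at this
    exact_mod_cast this
  submod X Y := by
    have := M.eRk_inter_add_eRk_union_le X Y
    simp only [← natCast_mRank] at this
    exact_mod_cast this

lemma sum_dartsTo {n : ℕ} {A : Type*} [AddCommMonoid A] (T : SimpleGraph (Fin n)) (v : Fin n)
    (g : Fin n → A) :
    ∑ d ∈ dartsTo T v, g d.toProd.1 = ∑ u with T.Adj u v, g u := by
  refine Finset.sum_bij (fun d _ => d.toProd.1) ?_ ?_ ?_ fun _ _ => rfl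
  · intro d hd
    simp only [dartsTo, Finset.mem_filter, Finset.mem_univ, true_and] at hd ⊢
    exact hd ▸ d.adj
  · intro d hd d' hd' h
    simp only [dartsTo, Finset.mem_filter, Finset.mem_univ, true_and] at hd hd'
    exact SimpleGraph.Dart.ext _ _ (Prod.ext h (hd.trans hd'.symm))
  · intro u hu
    exact ⟨⟨(u, v), by simpa using hu⟩, by simp [dartsTo], rfl⟩

lemma mBagWidth_le_iff {n : ℕ} (M : Matroid α) (T : SimpleGraph (Fin n)) (τ : α → Fin n)
    (v : Fin n) (w : ℕ) : mBagWidth M T τ v ≤ w ↔ bagSize (mRank M) T τ v ≤ w := by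
  have h1 : ∑ d ∈ dartsTo T v, mRank M (τ ⁻¹' branch T d)ᶜ =
      ∑ u with T.Adj u v, mRank M (lab T τ u v)ᶜ := by
    rw [← sum_dartsTo T v fun u => mRank M (lab T τ u v)ᶜ]
    refine Finset.sum_congr rfl fun d hd => ?_
    simp only [dartsTo, Finset.mem_filter, Finset.mem_univ, true_and] at hd
    rw [branch_eq_side, hd, lab]
  have h2 : (dartsTo T v).card = (Finset.univ.filter fun u => T.Adj u v).card := by
    simpa using sum_dartsTo T v fun _ => (1 : ℕ)
  rw [mBagWidth, bagSize, h1, h2, Finset.sum_sub_distrib, Finset.sum_const, nsmul_eq_mul,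
    ← Nat.cast_sum, ← Nat.cast_mul]
  omega

end Matroid

/-- Every matroid `M` admits a linked tree-decomposition of width at most
`tw(M)`. -/
theorem matroid_admits_linked_treeDecomposition {α : Type*} [Fintype α] (M : Matroid α)
    (hE : M.E = Set.univ) :
    ∃ (n : ℕ) (T : SimpleGraph (Fin n)) (τ : α → Fin n),
      T.IsTree ∧ mWidth M T τ ≤ matroidTreeWidth M ∧ IsLinkedMDecomp M T τ := by
  obtain ⟨n, T, hT, τ, hw⟩ : matroidTreeWidth M ∈ {w | ∃ (n : ℕ) (T : SimpleGraph (Fin n))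
      (_ : T.IsTree) (τ : α → Fin n), mWidth M T τ = w} :=
    Nat.sInf_mem ⟨_, 1, ⊤, .of_subsingleton, fun _ => 0, rfl⟩
  have hr := isRankFun_mRank M
  obtain ⟨m, T', τ', hT', hw', hlink⟩ := exists_isLinkedLab hr (w := matroidTreeWidth M) hT
    fun v => (mBagWidth_le_iff M T τ v _).1
      (hw ▸ Finset.le_sup (f := mBagWidth M T τ) (Finset.mem_univ v))
  exact ⟨m, T', τ', hT', Finset.sup_le fun v _ => (mBagWidth_le_iff M T' τ' v _).2 (hw' v), hlink⟩
end
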